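/- Let p ≥ 1 and δ ∈ (0,1) with α := δ − 1/p > 0, and set q = 1/δ. Let f : [0,1] → ℝ^d be continuous with B_{δ,p}(f; 0, 1) < ∞, where B_{δ,p}(f; s, t) = ∫_s^t ∫_s^t |f(u) − f(v)|^p / |u − v|^{1+δp} du dv. Then the function ω(s,t) := B_{δ,p}(f; s, t)^{q/p} · (t − s)^{αq} is superadditive: for all 0 ≤ s ≤ u ≤ t ≤ 1, ω(s,u) + ω(u,t) ≤ ω(s,t). (Note that q/p + αq = qδ = 1.) -/

import Mathlib

open Set MeasureTheory
open scoped ENNReal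

/-- The Besov-type double integral
`B_{δ,p}(f; s, t) = ∫_s^t ∫_s^t ‖f u − f v‖^p / |u − v|^(1+δp) du dv`,
valued in `ℝ≥0∞` so that it may be infinite. -/
noncomputable def besov (p δ : ℝ) {d : ℕ} (f : ℝ → EuclideanSpace ℝ (Fin d)) (s t : ℝ) : ℝ≥0∞ :=
  ∫⁻ u in Icc s t, ∫⁻ v in Icc s t,
    ENNReal.ofReal (‖f u - f v‖ ^ p / |u - v| ^ (1 + δ * p))

/-- `B_{δ,p}(f; ·, ·)` is superadditive: the squares `[s,u]²` and `[u,t]²` are almost disjoint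
subsets of `[s,t]²`. -/
theorem besov_add_le (p δ : ℝ) {d : ℕ} (f : ℝ → EuclideanSpace ℝ (Fin d)) {s u t : ℝ}
    (hsu : s ≤ u) (hut : u ≤ t) : besov p δ f s u + besov p δ f u t ≤ besov p δ f s t := by
  unfold besov
  rw [← Icc_union_Ioc_eq_Icc hsu hut, lintegral_union measurableSet_Ioc
    (Set.disjoint_left.2 fun x hx hx' => not_lt.2 hx.2 hx'.1), Icc_union_Ioc_eq_Icc hsu hut,
    ← setLIntegral_congr (Ioc_ae_eq_Icc (a := u) (b := t) (μ := volume))]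
  gcongr with x x

/-- `B_{δ,p}(f; ·, ·)` is monotone in the interval. -/
theorem besov_mono (p δ : ℝ) {d : ℕ} (f : ℝ → EuclideanSpace ℝ (Fin d)) {s t s' t' : ℝ}
    (h : Icc s t ⊆ Icc s' t') : besov p δ f s t ≤ besov p δ f s' t' :=
  (lintegral_mono fun _ => lintegral_mono_set h).trans (lintegral_mono_set h)

/-- Hölder's inequality for two terms, with conjugate exponents `1 / θ` and `1 / η`. -/
theorem rpow_mul_rpow_add_le {a b x y θ η : ℝ} (ha : 0 ≤ a) (hb : 0 ≤ b) (hx : 0 ≤ x)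
    (hy : 0 ≤ y) (hθ : 0 < θ) (hη : 0 < η) (h : θ + η = 1) :
    a ^ θ * x ^ η + b ^ θ * y ^ η ≤ (a + b) ^ θ * (x + y) ^ η := by
  rcases (add_nonneg ha hb).eq_or_lt with hA | hA
  · obtain ⟨rfl, rfl⟩ := (add_eq_zero_iff_of_nonneg ha hb).1 hA.symm
    simp [Real.zero_rpow hθ.ne']
  rcases (add_nonneg hx hy).eq_or_lt with hX | hX
  · obtain ⟨rfl, rfl⟩ := (add_eq_zero_iff_of_nonneg hx hy).1 hX.symm
    simp [Real.zero_rpow hη.ne']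
  have h₁ := Real.geom_mean_le_arith_mean2_weighted hθ.le hη.le
    (div_nonneg ha hA.le) (div_nonneg hx hX.le) h
  have h₂ := Real.geom_mean_le_arith_mean2_weighted hθ.le hη.le
    (div_nonneg hb hA.le) (div_nonneg hy hX.le) h
  rw [Real.div_rpow ha hA.le, Real.div_rpow hx hX.le, div_mul_div_comm] at h₁
  rw [Real.div_rpow hb hA.le, Real.div_rpow hy hX.le, div_mul_div_comm] at h₂
  have hsum : θ * (a / (a + b)) + η * (x / (x + y)) + (θ * (b / (a + b)) + η * (y / (x + y)))
      = 1 := by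
    rw [← h]
    field_simp
    ring
  have hle := (add_le_add h₁ h₂).trans_eq hsum
  rwa [← add_div, div_le_one (by positivity)] at hle

/-- For `p ≥ 1`, `δ ∈ (0,1)` with `α = δ − 1/p > 0`, `q = 1/δ`, and a continuous
`f : [0,1] → ℝ^d` with `B_{δ,p}(f; 0, 1) < ∞`, the function
`ω(s,t) = B_{δ,p}(f; s, t)^{q/p} (t − s)^{αq}` is superadditive on the simplex:
`ω(s,u) + ω(u,t) ≤ ω(s,t)` for `0 ≤ s ≤ u ≤ t ≤ 1`. -/
theorem besov_control_superadditive (p δ : ℝ) (hp : 1 ≤ p) (hδ : δ ∈ Ioo (0 : ℝ) 1)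
    (hα : 0 < δ - 1 / p) (d : ℕ) (f : ℝ → EuclideanSpace ℝ (Fin d))
    (hf : ContinuousOn f (Icc 0 1)) (hfin : besov p δ f 0 1 ≠ ⊤) :
    ∀ s u t : ℝ, 0 ≤ s → s ≤ u → u ≤ t → t ≤ 1 →
      (besov p δ f s u).toReal ^ ((1 / δ) / p) * (u - s) ^ ((δ - 1 / p) * (1 / δ)) +
        (besov p δ f u t).toReal ^ ((1 / δ) / p) * (t - u) ^ ((δ - 1 / p) * (1 / δ)) ≤
      (besov p δ f s t).toReal ^ ((1 / δ) / p) * (t - s) ^ ((δ - 1 / p) * (1 / δ)) := by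
  intro s u t hs hsu hut ht
  have hδ0 := hδ.1
  have hp0 : 0 < p := by linarith
  have hst : besov p δ f s t ≠ ⊤ := ne_top_of_le_ne_top hfin (besov_mono p δ f (Icc_subset_Icc hs ht))
  have hadd := besov_add_le p δ f hsu hut
  have hsu' := ne_top_of_le_ne_top hst (le_self_add.trans hadd)
  have hut' := ne_top_of_le_ne_top hst (le_add_self.trans hadd)
  have hreal := ENNReal.toReal_mono hst hadd
  rw [ENNReal.toReal_add hsu' hut'] at hreal
  have hH := rpow_mul_rpow_add_le (θ := 1 / δ / p) (η := (δ - 1 / p) * (1 / δ))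
    (ENNReal.toReal_nonneg (a := besov p δ f s u)) (ENNReal.toReal_nonneg (a := besov p δ f u t))
    (sub_nonneg.2 hsu) (sub_nonneg.2 hut) (by positivity) (by positivity) (by field_simp; ring)
  rw [show u - s + (t - u) = t - s by ring] at hH
  have hts : 0 ≤ t - s := by linarith
  exact hH.trans (by gcongr)
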